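/- For all m, n ≥ 1, k ≥ 0 and 1 ≤ s ≤ n+1, one has Tqt★(n,m;s;k) = RPqt★(n,m;s;k) in ℤ[q,t]. -/

import Mathlib

open Finset

/- ## Reduced parallelogram polyominoes

Letters of the ordered alphabet `0 < 0̄ < 1 < 1̄ < 2 < 2̄ < ⋯` are encoded as natural
numbers: the letter with numeric value `v` is encoded as `2*v` if unbarred and as
`2*v+1` if barred.  With this encoding the order of the alphabet is the order of `ℕ`,
the successor in the alphabet is `+1`, the numeric value of a letter `c` is `c / 2`,
and a letter is barred iff `c % 2 = 1`. -/

/-- A reduced parallelogram polyomino of size `m × n`: a pair of `{0,1}`-sequences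
(`true` = north step, `false` = east step) of length `m+n`, each with `n` north steps,
the red path staying weakly above the green one. -/
structure RedPoly (m n : ℕ) where
  red : Fin (m + n) → Bool
  green : Fin (m + n) → Bool
  red_count : (univ.filter fun i => red i = true).card = n
  green_count : (univ.filter fun i => green i = true).card = n
  green_le_red : ∀ i : Fin (m + n),
    (univ.filter fun j => j ≤ i ∧ green j = true).card ≤
    (univ.filter fun j => j ≤ i ∧ red j = true).card

/-- Number of `true` entries strictly before position `j`. -/
def truesBefore {N : ℕ} (p : Fin N → Bool) (j : Fin N) : ℕ :=
  (univ.filter fun l => l < j ∧ p l = true).card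

/-- Number of `false` entries strictly before position `j`. -/
def falsesBefore {N : ℕ} (p : Fin N → Bool) (j : Fin N) : ℕ :=
  (univ.filter fun l => l < j ∧ p l = false).card

/-- The height of the lattice path `p` over the column `[x, x+1]`, i.e. the number of
north steps occurring before the `(x+1)`-st east step. -/
def heightAt {N : ℕ} (p : Fin N → Bool) (x : ℕ) : ℕ :=
  (univ.filter fun j => p j = true ∧ falsesBefore p j ≤ x).card

/-- The `x`-coordinate at which the lattice path `p` makes its north step from height
`y` to height `y+1`, i.e. the number of east steps occurring before the `(y+1)`-st
north step. -/
def xcoordAt {N : ℕ} (p : Fin N → Bool) (y : ℕ) : ℕ :=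
  (univ.filter fun j => p j = false ∧ truesBefore p j ≤ y).card

/-- Reading a sequence of northeast (`true`) / southeast (`false`) steps starting at
height `h`, record for each northeast step the (encoded) letter of the level at which
it ends: a northeast step from height `h` to `h+1` ends at level `h+1`, whose letter is
the `(h+1)`-st letter of the alphabet, encoded as `h`. -/
def areaWordAux : ℕ → List Bool → List ℕ
  | _, [] => []
  | h, true :: rest => h :: areaWordAux (h + 1) rest
  | h, false :: rest => areaWordAux (h - 1) rest

/-- The interlaced Dyck path `D = (1, r₁, 1-g₁, r₂, 1-g₂, …, r_{m+n}, 1-g_{m+n}, 0)`. -/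
def interlaced {m n : ℕ} (P : RedPoly m n) : List Bool :=
  true :: ((List.ofFn fun i : Fin (m + n) => [P.red i, !P.green i]).flatten ++ [false])

/-- The area word of a reduced parallelogram polyomino (letters encoded in `ℕ`). -/
def areaWord {m n : ℕ} (P : RedPoly m n) : List ℕ :=
  areaWordAux 0 (interlaced P)

/-- `area`: the sum of the numeric values of the letters of the area word. -/
def areaStat {m n : ℕ} (P : RedPoly m n) : ℕ :=
  ((areaWord P).map fun c => c / 2).sum

/-- `dinv`: the number of pairs of positions `i < j` in the area word such that the
letter in position `i` is the successor (in the alphabet) of the letter in position `j`. -/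
def dinvStat {m n : ℕ} (P : RedPoly m n) : ℕ :=
  ((Finset.range (areaWord P).length ×ˢ Finset.range (areaWord P).length).filter
    fun p => p.1 < p.2 ∧ (areaWord P).getD p.1 0 = (areaWord P).getD p.2 0 + 1).card

/-- `d` is the position of the unbarred letter of a rise of the word `w`: the letter at
position `d-1` is barred and the letter at position `d` is its successor in the
alphabet. -/
def IsRise (w : List ℕ) (d : ℕ) : Prop :=
  0 < d ∧ d < w.length ∧ w.getD (d - 1) 0 % 2 = 1 ∧ w.getD d 0 = w.getD (d - 1) 0 + 1

/-- An `m × n` reduced parallelogram polyomino with `k` decorated rises (the marks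
record the positions of the unbarred letters of the marked rises in the area word). -/
structure RiseDecorated (m n k : ℕ) where
  poly : RedPoly m n
  marks : Finset ℕ
  marks_card : marks.card = k
  marks_rise : ∀ d ∈ marks, IsRise (areaWord poly) d

/-- `underlined-area`: the sum of the numeric values of the letters of the area word,
the marked letters excepted. -/
def uArea {m n k : ℕ} (Q : RiseDecorated m n k) : ℕ :=
  ∑ i ∈ Finset.range (areaWord Q.poly).length \ Q.marks, (areaWord Q.poly).getD i 0 / 2

/-- The corner points of the bounce path: `bouncePt P k = (X k, Y k)` where the
`(k+1)`-st vertical run goes from height `Y k` up to `Y (k+1)` (the height at which the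
red path makes its east step over the current column), and the `(k+1)`-st horizontal
run goes from `X k` to `X (k+1)` (the `x`-coordinate at which the green path makes its
north step from the current height). -/
def bouncePt {m n : ℕ} (P : RedPoly m n) : ℕ → ℕ × ℕ
  | 0 => (0, 0)
  | k + 1 =>
    (xcoordAt P.green (heightAt P.red (bouncePt P k).1),
     heightAt P.red (bouncePt P k).1)

/-- The numeric value of the label of the vertical step of the bounce path in row `y`
(the vertical steps of the `(k+1)`-st vertical run carry the unbarred letter `k`). -/
def vertLabel {m n : ℕ} (P : RedPoly m n) (y : ℕ) : ℕ :=
  ((Finset.range (m + n)).filter fun k => (bouncePt P (k + 1)).2 ≤ y).card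

/-- The numeric value of the label of the horizontal step of the bounce path in column
`x` (the horizontal steps of the `(k+1)`-st horizontal run carry the barred letter `k̄`). -/
def horLabel {m n : ℕ} (P : RedPoly m n) (x : ℕ) : ℕ :=
  ((Finset.range (m + n)).filter fun k => (bouncePt P (k + 1)).1 ≤ x).card

/-- `bounce`: the sum of the numeric values of the labels of the bounce path. -/
def bounceStat {m n : ℕ} (P : RedPoly m n) : ℕ :=
  (∑ y ∈ Finset.range n, vertLabel P y) + ∑ x ∈ Finset.range m, horLabel P x

/-- The number of labels of the bounce path equal to the (unbarred) letter `0`. -/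
def zeroLabelCount {m n : ℕ} (P : RedPoly m n) : ℕ :=
  ((Finset.range n).filter fun y => vertLabel P y = 0).card

/-- A red valley: a north step of the red path preceded by an east step. -/
def IsRedValley {m n : ℕ} (P : RedPoly m n) (j : Fin (m + n)) : Prop :=
  P.red j = true ∧ ∃ i : Fin (m + n), (i : ℕ) + 1 = (j : ℕ) ∧ P.red i = false

/-- The row (counted from `0`) occupied by the north step `j` of the red path. -/
def rowOf {m n : ℕ} (P : RedPoly m n) (j : Fin (m + n)) : ℕ :=
  truesBefore P.red j

/-- An `m × n` reduced parallelogram polyomino with `k` decorated red valleys. -/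
structure ValleyDecorated (m n k : ℕ) where
  poly : RedPoly m n
  marks : Finset (Fin (m + n))
  marks_card : marks.card = k
  marks_valley : ∀ j ∈ marks, IsRedValley poly j

/-- `underlined-bounce`: the sum of the numeric values of the labels of the bounce
path, excluding the labels of the bounce-path steps lying in the same row as a marked
valley. -/
def uBounce {m n k : ℕ} (Q : ValleyDecorated m n k) : ℕ :=
  (∑ y ∈ Finset.range n \ Q.marks.image (rowOf Q.poly), vertLabel Q.poly y) +
    ∑ x ∈ Finset.range m, horLabel Q.poly x

/- ## q,t-enumerators -/

/-- `q`, as an element of `ℤ[q,t] = MvPolynomial (Fin 2) ℤ`. -/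
noncomputable def Xq : MvPolynomial (Fin 2) ℤ := MvPolynomial.X 0

/-- `t`, as an element of `ℤ[q,t] = MvPolynomial (Fin 2) ℤ`. -/
noncomputable def Xt : MvPolynomial (Fin 2) ℤ := MvPolynomial.X 1

/-- The Gaussian `q`-binomial coefficient `[a choose b]_x`, defined by the `q`-Pascal
recursion `[a+1 choose b+1] = [a choose b] + x^(b+1) * [a choose b+1]`. -/
def qbinom {R : Type*} [CommSemiring R] (x : R) : ℕ → ℕ → R
  | _, 0 => 1
  | 0, _ + 1 => 0
  | a + 1, b + 1 => qbinom x a b + x ^ (b + 1) * qbinom x a (b + 1)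

/-- `RPqt•(m,n;s;k)`: the `(area, underlined-bounce)` `q,t`-enumerator of `m × n`
reduced polyominoes with `k` decorated red valleys whose bounce path carries exactly
`s-1` labels equal to the letter `0`. -/
noncomputable def RPbullet (m n s k : ℕ) : MvPolynomial (Fin 2) ℤ :=
  ∑ᶠ Q : ValleyDecorated m n k,
    if zeroLabelCount Q.poly + 1 = s then Xq ^ areaStat Q.poly * Xt ^ uBounce Q else 0

/-- `RPqt★(a,b;s;k)`: the `(dinv, underlined-area)` `q,t`-enumerator of `a × b` reduced
polyominoes with `k` decorated rises whose area word contains exactly `s` letters equal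
to the unbarred letter `0`. -/
noncomputable def RPstar (a b s k : ℕ) : MvPolynomial (Fin 2) ℤ :=
  ∑ᶠ Q : RiseDecorated a b k,
    if (areaWord Q.poly).count 0 = s then Xq ^ dinvStat Q.poly * Xt ^ uArea Q else 0

/- ## Two cars parking functions -/

/-- A two-cars parking function of size `N`, encoded by its area word `a` and its
labels `l`: `a` is the area word of a Dyck path (`a₀ = 0` and `a` increases by at most
`1` at each step), the labels are `1` or `2` and strictly increase bottom to top within
each column (two consecutive north steps lie in the same column exactly when the area
word increases by `1`). -/
structure TwoCarsPF (N : ℕ) where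
  a : Fin N → ℕ
  l : Fin N → ℕ
  a_first : ∀ i : Fin N, (i : ℕ) = 0 → a i = 0
  a_step : ∀ i j : Fin N, (i : ℕ) + 1 = (j : ℕ) → a j ≤ a i + 1
  col_incr : ∀ i j : Fin N, (i : ℕ) + 1 = (j : ℕ) → a j = a i + 1 → l i < l j
  l_one_le : ∀ i, 1 ≤ l i
  l_le_two : ∀ i, l i ≤ 2

/-- `dinv` of a (two-cars) parking function. -/
def pfDinv {N : ℕ} (F : TwoCarsPF N) : ℕ :=
  (univ.filter fun p : Fin N × Fin N =>
    p.1 < p.2 ∧ ((F.a p.1 = F.a p.2 ∧ F.l p.1 < F.l p.2) ∨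
      (F.a p.1 = F.a p.2 + 1 ∧ F.l p.2 < F.l p.1))).card

/-- A rise of a parking function: an index whose area word entry is one more than the
previous one. -/
def IsPFRise {N : ℕ} (F : TwoCarsPF N) (i : Fin N) : Prop :=
  ∃ j : Fin N, (j : ℕ) + 1 = (i : ℕ) ∧ F.a i = F.a j + 1

/-- A two-cars parking function of size `m+n` with `n` labels equal to `1`, `m` labels
equal to `2`, and `k` decorated rises. -/
structure DecTwoCarsPF (m n k : ℕ) where
  pf : TwoCarsPF (m + n)
  ones_count : (univ.filter fun i => pf.l i = 1).card = n
  twos_count : (univ.filter fun i => pf.l i = 2).card = m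
  marks : Finset (Fin (m + n))
  marks_card : marks.card = k
  marks_rise : ∀ i ∈ marks, IsPFRise pf i

/-- `underlined-area` of a decorated parking function: the sum of the area word entries
over the non-marked indices. -/
def pfUArea {m n k : ℕ} (F : DecTwoCarsPF m n k) : ℕ :=
  ∑ i ∈ univ \ F.marks, F.pf.a i

/-- The number of labels equal to `2` lying on the main diagonal. -/
def diagTwos {N : ℕ} (F : TwoCarsPF N) : ℕ :=
  (univ.filter fun i => F.a i = 0 ∧ F.l i = 2).card

/-- `Tqt★(a,b;s;k)`: the `(dinv, underlined-area)` `q,t`-enumerator of two-cars parking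
functions of size `a+b` with `b` labels equal to `1`, `a` labels equal to `2`, exactly
`s-1` labels equal to `2` on the main diagonal, and `k` decorated rises. -/
noncomputable def Tstar (a b s k : ℕ) : MvPolynomial (Fin 2) ℤ :=
  ∑ᶠ F : DecTwoCarsPF a b k,
    if diagTwos F.pf + 1 = s then Xq ^ pfDinv F.pf * Xt ^ pfUArea F else 0

/- ## Partially labelled Dyck paths (all rises decorated, all valleys blank) -/

/-- A valley of a Dyck path (in terms of its area word): a north step preceded by an
east step. -/
def IsValleyW {N : ℕ} (a : Fin N → ℕ) (i : Fin N) : Prop :=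
  ∃ j : Fin N, (j : ℕ) + 1 = (i : ℕ) ∧ a i ≤ a j

/-- A rise of a Dyck path (in terms of its area word): a north step preceded by a north
step. -/
def IsRiseW {N : ℕ} (a : Fin N → ℕ) (i : Fin N) : Prop :=
  ∃ j : Fin N, (j : ℕ) + 1 = (i : ℕ) ∧ a i = a j + 1

instance {N : ℕ} (a : Fin N → ℕ) : DecidablePred (IsValleyW a) := fun i =>
  inferInstanceAs (Decidable (∃ j : Fin N, (j : ℕ) + 1 = (i : ℕ) ∧ a i ≤ a j))

instance {N : ℕ} (a : Fin N → ℕ) : DecidablePred (IsRiseW a) := fun i =>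
  inferInstanceAs (Decidable (∃ j : Fin N, (j : ℕ) + 1 = (i : ℕ) ∧ a i = a j + 1))

/-- An element of `PLDP(m,n)^{★n}`: a partially labelled Dyck path of size `m+n+1`
(encoded by the area word `a` of the Dyck path and the labels `l` of its north steps,
with `0` denoting a blank) with `n+1` positive labels and `m` blanks, in which every
valley is a blank, every blank is a valley, labels strictly increase bottom to top in
each column, and every rise is decorated. -/
structure PLDPall (m n : ℕ) where
  a : Fin (m + n + 1) → ℕ
  l : Fin (m + n + 1) → ℕ
  a_first : ∀ i : Fin (m + n + 1), (i : ℕ) = 0 → a i = 0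
  a_step : ∀ i j : Fin (m + n + 1), (i : ℕ) + 1 = (j : ℕ) → a j ≤ a i + 1
  col_incr : ∀ i j : Fin (m + n + 1), (i : ℕ) + 1 = (j : ℕ) → a j = a i + 1 → l i < l j
  blank_iff_valley : ∀ i, l i = 0 ↔ IsValleyW a i
  blank_count : (univ.filter fun i => l i = 0).card = m

/-- `underlined-area` of an element of `PLDP(m,n)^{★n}`: the sum of the area word
entries over the north steps that are not (decorated) rises. -/
def pldpUArea {m n : ℕ} (D : PLDPall m n) : ℕ :=
  ∑ i ∈ univ.filter (fun i => ¬ IsRiseW D.a i), D.a i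

/-- A labelled reduced polyomino of size `m × n`: an `m × n` reduced parallelogram
polyomino together with `n+1` positive integer labels, one below the first column
(index `0`) and one on each north step of the red path (the north step with `j` north
steps before it getting the label of index `j+1`), such that labels strictly increase
bottom to top within each column (the label below the first column being treated as an
artificial north step at the very beginning of the red path). -/
structure LabelledRP (m n : ℕ) where
  poly : RedPoly m n
  lab : Fin (n + 1) → ℕ
  lab_pos : ∀ j, 1 ≤ lab j
  col_incr : ∀ p : Fin (m + n), poly.red p = true →
    ((p : ℕ) = 0 ∨ ∃ q : Fin (m + n), (q : ℕ) + 1 = (p : ℕ) ∧ poly.red q = true) →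
    ∀ h : truesBefore poly.red p + 1 < n + 1,
      lab ⟨truesBefore poly.red p, Nat.lt_of_succ_lt h⟩ <
      lab ⟨truesBefore poly.red p + 1, h⟩

/- ## Dyck paths and their area words -/

/-- A sequence of northeast (`true`) / southeast (`false`) steps starting at height `h`
stays weakly above height `0` and ends at height `0`. -/
def IsDyckFrom : ℕ → List Bool → Prop
  | h, [] => h = 0
  | h, true :: D => IsDyckFrom (h + 1) D
  | h, false :: D => 0 < h ∧ IsDyckFrom (h - 1) D

/-- The first letter of a word is at most `h`, and every other letter is at most the
successor of the letter before it. -/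
def IsAreaWordFrom : ℕ → List ℕ → Prop
  | _, [] => True
  | h, c :: w => c ≤ h ∧ IsAreaWordFrom (c + 1) w

/-- The path starting at height `h` and ending at height `0` with a given area word. -/
def dyckOfWord : ℕ → List ℕ → List Bool
  | h, [] => List.replicate h false
  | h, c :: w => List.replicate (h - c) false ++ true :: dyckOfWord (c + 1) w

lemma isAreaWordFrom_mono {h h' : ℕ} (hh : h ≤ h') {w : List ℕ}
    (hw : IsAreaWordFrom h w) : IsAreaWordFrom h' w := by
  cases w with
  | nil => trivial
  | cons c w => exact ⟨hw.1.trans hh, hw.2⟩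

lemma isAreaWordFrom_areaWordAux (D : List Bool) (h : ℕ) (hD : IsDyckFrom h D) :
    IsAreaWordFrom h (areaWordAux h D) := by
  induction D generalizing h with
  | nil => trivial
  | cons b D ih =>
    cases b with
    | true => exact ⟨le_rfl, ih _ hD⟩
    | false => exact isAreaWordFrom_mono (Nat.sub_le h 1) (ih _ hD.2)

lemma length_eq_of_isDyckFrom (D : List Bool) (h : ℕ) (hD : IsDyckFrom h D) :
    D.length = h + 2 * (areaWordAux h D).length := by
  induction D generalizing h with
  | nil => simp_all [IsDyckFrom, areaWordAux]
  | cons b D ih =>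
    cases b with
    | true =>
      have := ih _ hD
      simp only [areaWordAux, List.length_cons]
      omega
    | false =>
      have := ih _ hD.2
      have := hD.1
      simp only [areaWordAux, List.length_cons]
      omega

lemma dyckOfWord_succ {h : ℕ} {w : List ℕ} (hw : IsAreaWordFrom h w) :
    dyckOfWord (h + 1) w = false :: dyckOfWord h w := by
  cases w with
  | nil => simp [dyckOfWord, List.replicate_succ]
  | cons c w => simp [dyckOfWord, Nat.succ_sub hw.1, List.replicate_succ]

lemma dyckOfWord_areaWordAux (D : List Bool) (h : ℕ) (hD : IsDyckFrom h D) :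
    dyckOfWord h (areaWordAux h D) = D := by
  induction D generalizing h with
  | nil => simp_all [IsDyckFrom, areaWordAux, dyckOfWord]
  | cons b D ih =>
    cases b with
    | true => simp [areaWordAux, dyckOfWord, ih _ hD]
    | false =>
      obtain ⟨hpos, hD⟩ := hD
      obtain ⟨h, rfl⟩ := Nat.exists_eq_add_of_lt hpos
      simp only [zero_add, Nat.add_sub_cancel] at hD
      simp only [zero_add, areaWordAux, Nat.add_sub_cancel]
      rw [dyckOfWord_succ (isAreaWordFrom_areaWordAux D h hD), ih _ hD]

lemma isDyckFrom_replicate_append (j h : ℕ) (D : List Bool) (hD : IsDyckFrom h D) :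
    IsDyckFrom (h + j) (List.replicate j false ++ D) := by
  induction j with
  | zero => simpa using hD
  | succ j ih => exact ⟨by omega, ih⟩

lemma areaWordAux_replicate_append (j h : ℕ) (D : List Bool) :
    areaWordAux (h + j) (List.replicate j false ++ D) = areaWordAux h D := by
  induction j with
  | zero => simp
  | succ j ih => exact ih

lemma isDyckFrom_dyckOfWord (w : List ℕ) (h : ℕ) (hw : IsAreaWordFrom h w) :
    IsDyckFrom h (dyckOfWord h w) := by
  induction w generalizing h with
  | nil => simpa [dyckOfWord] using isDyckFrom_replicate_append h 0 [] rfl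
  | cons c w ih =>
    have := isDyckFrom_replicate_append (h - c) c (true :: dyckOfWord (c + 1) w) (ih _ hw.2)
    rwa [Nat.add_sub_cancel' hw.1] at this

lemma areaWordAux_dyckOfWord (w : List ℕ) (h : ℕ) (hw : IsAreaWordFrom h w) :
    areaWordAux h (dyckOfWord h w) = w := by
  induction w generalizing h with
  | nil => simpa [dyckOfWord, areaWordAux] using areaWordAux_replicate_append h 0 []
  | cons c w ih =>
    have := areaWordAux_replicate_append (h - c) c (true :: dyckOfWord (c + 1) w)
    rw [Nat.add_sub_cancel' hw.1] at this
    simp only [dyckOfWord, this, areaWordAux, ih _ hw.2]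

lemma getD_succ_le_of_isAreaWordFrom (w : List ℕ) (h : ℕ) (hw : IsAreaWordFrom h w) (i : ℕ) :
    w.getD (i + 1) 0 ≤ w.getD i 0 + 1 := by
  induction w generalizing h i with
  | nil => simp
  | cons c w ih =>
    cases i with
    | zero =>
      cases w with
      | nil => simp
      | cons c' w => simpa using hw.2.1
    | succ i => simpa using ih _ hw.2 i

lemma isAreaWordFrom_ofFn {N : ℕ} (f : Fin N → ℕ) (h : ℕ)
    (h0 : ∀ i : Fin N, (i : ℕ) = 0 → f i ≤ h)
    (hs : ∀ i j : Fin N, (i : ℕ) + 1 = (j : ℕ) → f j ≤ f i + 1) :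
    IsAreaWordFrom h (List.ofFn f) := by
  induction N generalizing h with
  | zero => trivial
  | succ N ih =>
    rw [List.ofFn_succ]
    refine ⟨h0 0 rfl, ih _ _ (fun i hi => hs 0 i.succ (by simp [hi])) fun i j hij => ?_⟩
    exact hs i.succ j.succ (by simp [hij])

/- ## Interlacing two lattice paths -/

/-- The steps `r₁, 1-g₁, r₂, 1-g₂, …` of a list of pairs `(r₁, g₁), (r₂, g₂), …`. -/
def interlacedSteps (L : List (Bool × Bool)) : List Bool :=
  L.flatMap fun p => [p.1, !p.2]

lemma interlacedSteps_injective : Function.Injective interlacedSteps := by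
  intro L L' h
  induction L generalizing L' with
  | nil => cases L' <;> simp_all [interlacedSteps]
  | cons p L ih =>
    cases L' with
    | nil => simp [interlacedSteps] at h
    | cons p' L' =>
      simp only [interlacedSteps, List.flatMap_cons, List.cons_append, List.nil_append,
        List.cons.injEq, Bool.not_inj_iff] at h
      rw [ih h.2.2, Prod.ext h.1 h.2.1]

lemma exists_interlacedSteps (N h : ℕ) (D : List Bool) (hD : IsDyckFrom h D)
    (hlen : D.length = 2 * N + 1) :
    ∃ L : List (Bool × Bool), L.length = N ∧ D = interlacedSteps L ++ [false] := by
  induction N generalizing h D with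
  | zero =>
    obtain ⟨b, rfl⟩ := List.length_eq_one_iff.1 hlen
    cases b with
    | true => exact absurd hD (Nat.succ_ne_zero h)
    | false => exact ⟨[], rfl, rfl⟩
  | succ N ih =>
    match D, hlen with
    | r :: g :: D, hlen =>
      have key : ∃ h', IsDyckFrom h' D := by
        cases r <;> cases g <;> simp only [IsDyckFrom] at hD
        exacts [⟨_, hD.2.2⟩, ⟨_, hD.2⟩, ⟨_, hD.2⟩, ⟨_, hD⟩]
      obtain ⟨h', hD'⟩ := key
      obtain ⟨L, hL, rfl⟩ := ih h' D hD' (by simp at hlen; omega)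
      exact ⟨(r, !g) :: L, by simp [hL], by simp [interlacedSteps]⟩

lemma isDyckFrom_interlacedSteps (L : List (Bool × Bool)) (d : ℕ) :
    IsDyckFrom (2 * d + 1) (interlacedSteps L ++ [false]) ↔
      (∀ i, (L.take i).countP Prod.snd ≤ d + (L.take i).countP Prod.fst) ∧
        L.countP Prod.snd = d + L.countP Prod.fst := by
  induction L generalizing d with
  | nil =>
    simp [interlacedSteps, IsDyckFrom]
    omega
  | cons p L ih =>
    rw [← Nat.and_forall_add_one]
    obtain ⟨_ | _, _ | _⟩ := p
    · have := ih d
      simp_all [interlacedSteps, IsDyckFrom]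
    · cases d with
      | zero =>
        simp only [interlacedSteps, List.flatMap_cons, IsDyckFrom, List.cons_append,
          Bool.not_true]
        constructor
        · intro h
          exact absurd h.2.1 (by simp)
        · intro h
          have := h.1.2 0
          simp at this
      | succ d =>
        have := ih d
        simp_all [interlacedSteps, IsDyckFrom, mul_add]
        grind
    · have := ih (d + 1)
      simp_all [interlacedSteps, IsDyckFrom, mul_add]
      grind
    · have := ih d
      simp_all [interlacedSteps, IsDyckFrom]
      grind

lemma countP_odd_areaWordAux (L : List (Bool × Bool)) (d : ℕ)
    (hD : IsDyckFrom (2 * d + 1) (interlacedSteps L ++ [false])) :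
    (areaWordAux (2 * d + 1) (interlacedSteps L ++ [false])).countP (fun c => c % 2 = 1) =
      L.countP Prod.fst := by
  induction L generalizing d with
  | nil => rfl
  | cons p L ih =>
    obtain ⟨_ | _, _ | _⟩ := p <;>
      simp only [interlacedSteps, List.flatMap_cons, List.cons_append, List.nil_append,
        IsDyckFrom, Bool.not_true, Bool.not_false, areaWordAux] at hD ⊢
    · have h1 : 2 * d + 1 - 1 + 1 = 2 * d + 1 := by omega
      rw [h1] at hD ⊢
      have := ih d hD.2
      simp_all [interlacedSteps]
    · obtain ⟨e, rfl⟩ : ∃ e, d = e + 1 := ⟨d - 1, by omega⟩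
      have h1 : 2 * (e + 1) + 1 - 1 - 1 = 2 * e + 1 := by omega
      rw [h1] at hD ⊢
      have := ih e hD.2.2
      simp_all [interlacedSteps]
    · have h1 : 2 * d + 1 + 1 + 1 = 2 * (d + 1) + 1 := by omega
      rw [h1] at hD ⊢
      have := ih (d + 1) hD
      have h2 : ¬ (2 * d + 1 + 1) % 2 = 1 := by omega
      simp_all [interlacedSteps]
    · have h1 : 2 * d + 1 + 1 - 1 = 2 * d + 1 := by omega
      rw [h1] at hD ⊢
      have := ih d hD.2
      simp_all [interlacedSteps]

lemma countP_take_ofFn {α : Type*} {N : ℕ} (f : Fin N → α) (p : α → Bool) (i : ℕ) :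
    ((List.ofFn f).take i).countP p = (univ.filter fun j : Fin N => (j : ℕ) < i ∧ p (f j)).card := by
  induction N generalizing i with
  | zero => simp
  | succ N ih =>
    cases i with
    | zero => simp
    | succ i =>
      rw [List.ofFn_succ, List.take_succ_cons, List.countP_cons, ih, Fin.card_filter_univ_succ]
      simp only [Fin.val_zero, Nat.zero_lt_succ, true_and, Fin.val_succ,
        Nat.add_lt_add_iff_right]
      split_ifs <;> rfl

lemma countP_ofFn {α : Type*} {N : ℕ} (f : Fin N → α) (p : α → Bool) :
    (List.ofFn f).countP p = (univ.filter fun j : Fin N => p (f j)).card := by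
  have := countP_take_ofFn f p N
  rw [List.take_of_length_le (by simp)] at this
  rw [this]
  congr 1
  ext j
  simp

namespace RedPoly

variable {m n : ℕ}

/-- The pairs of simultaneous steps of the red and the green path. -/
def pairs (P : RedPoly m n) : List (Bool × Bool) :=
  List.ofFn fun i => (P.red i, P.green i)

lemma interlaced_eq (P : RedPoly m n) :
    interlaced P = true :: (interlacedSteps P.pairs ++ [false]) := by
  simp only [interlaced, interlacedSteps, pairs, List.flatMap, List.map_ofFn]
  rfl

lemma pairs_injective : Function.Injective (pairs (m := m) (n := n)) := by
  intro P P' h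
  have h' := List.ofFn_injective h
  have hr : P.red = P'.red := funext fun i => congrArg Prod.fst (congrFun h' i)
  have hg : P.green = P'.green := funext fun i => congrArg Prod.snd (congrFun h' i)
  cases P
  cases P'
  simp_all

lemma countP_fst_pairs (P : RedPoly m n) : P.pairs.countP Prod.fst = n := by
  rw [pairs, countP_ofFn]
  exact P.red_count

lemma countP_snd_pairs (P : RedPoly m n) : P.pairs.countP Prod.snd = n := by
  rw [pairs, countP_ofFn]
  exact P.green_count

lemma isDyckFrom_pairs (P : RedPoly m n) :
    IsDyckFrom 1 (interlacedSteps P.pairs ++ [false]) := by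
  refine (isDyckFrom_interlacedSteps P.pairs 0).2 ⟨fun i => ?_, ?_⟩
  · obtain hi | hi := le_or_gt (m + n) i
    · rw [List.take_of_length_le (by simpa [pairs] using hi), countP_fst_pairs,
        countP_snd_pairs, zero_add]
    · cases i with
      | zero => simp
      | succ i =>
        have := P.green_le_red ⟨i, by omega⟩
        rw [pairs, countP_take_ofFn, countP_take_ofFn, zero_add]
        simpa only [Fin.le_def, Nat.lt_succ_iff] using this
  · rw [countP_fst_pairs, countP_snd_pairs, zero_add]

lemma isDyckFrom_interlaced (P : RedPoly m n) : IsDyckFrom 0 (interlaced P) := by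
  rw [interlaced_eq]
  exact P.isDyckFrom_pairs

lemma areaWord_injective : Function.Injective (areaWord (m := m) (n := n)) := by
  intro P P' h
  have h' := congrArg (dyckOfWord 0) h
  rw [areaWord, areaWord, dyckOfWord_areaWordAux _ _ P.isDyckFrom_interlaced,
    dyckOfWord_areaWordAux _ _ P'.isDyckFrom_interlaced, interlaced_eq, interlaced_eq,
    List.cons.injEq, List.append_left_inj] at h'
  exact pairs_injective (interlacedSteps_injective h'.2)

lemma areaWord_eq_cons (P : RedPoly m n) :
    areaWord P = 0 :: areaWordAux 1 (interlacedSteps P.pairs ++ [false]) := by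
  rw [areaWord, interlaced_eq]
  rfl

lemma length_areaWord (P : RedPoly m n) : (areaWord P).length = m + n + 1 := by
  have := length_eq_of_isDyckFrom _ _ P.isDyckFrom_interlaced
  have hlen : ∀ L : List (Bool × Bool), (interlacedSteps L).length = 2 * L.length := by
    intro L
    simp [interlacedSteps, mul_comm]
  rw [← areaWord, interlaced_eq] at this
  simp only [List.length_cons, List.length_append, hlen, pairs, List.length_ofFn,
    List.length_nil] at this
  omega

/-- The `(i+1)`-st letter of the area word after its initial letter `0`. -/
def letter (P : RedPoly m n) (i : Fin (m + n)) : ℕ :=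
  (areaWord P).getD (i + 1) 0

lemma areaWord_eq_cons_ofFn (P : RedPoly m n) : areaWord P = 0 :: List.ofFn P.letter := by
  refine List.ext_getElem (by simp [length_areaWord]) fun i h1 h2 => ?_
  cases i with
  | zero => simp [areaWord_eq_cons]
  | succ i => rw [List.getElem_cons_succ, List.getElem_ofFn, letter, List.getD_eq_getElem _ _ h1]

lemma getD_areaWord_zero (P : RedPoly m n) : (areaWord P).getD 0 0 = 0 := by
  simp [areaWord_eq_cons]

lemma getD_areaWord_succ_le (P : RedPoly m n) (i : ℕ) :
    (areaWord P).getD (i + 1) 0 ≤ (areaWord P).getD i 0 + 1 :=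
  getD_succ_le_of_isAreaWordFrom _ 0
    (isAreaWordFrom_areaWordAux _ _ P.isDyckFrom_interlaced) i

lemma card_odd_letter (P : RedPoly m n) :
    (univ.filter fun i => P.letter i % 2 = 1).card = n := by
  have h := countP_odd_areaWordAux P.pairs 0 P.isDyckFrom_pairs
  have h' := P.areaWord_eq_cons.symm.trans P.areaWord_eq_cons_ofFn
  rw [List.cons.injEq] at h'
  rw [mul_zero, zero_add, h'.2, countP_fst_pairs, countP_ofFn] at h
  simpa using h

lemma exists_areaWord_eq (f : Fin (m + n) → ℕ)
    (h0 : ∀ i : Fin (m + n), (i : ℕ) = 0 → f i ≤ 1)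
    (hs : ∀ i j : Fin (m + n), (i : ℕ) + 1 = (j : ℕ) → f j ≤ f i + 1)
    (hodd : (univ.filter fun i => f i % 2 = 1).card = n) :
    ∃ P : RedPoly m n, areaWord P = 0 :: List.ofFn f := by
  have hw := isAreaWordFrom_ofFn f 1 h0 hs
  have hD := isDyckFrom_dyckOfWord _ _ hw
  have hlen := length_eq_of_isDyckFrom _ _ hD
  have hword := areaWordAux_dyckOfWord _ _ hw
  rw [hword, List.length_ofFn, Nat.add_comm 1] at hlen
  obtain ⟨L, hL, hDL⟩ := exists_interlacedSteps _ _ _ hD hlen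
  rw [hDL] at hword hD
  obtain ⟨p, rfl⟩ : ∃ p : Fin (m + n) → Bool × Bool, L = List.ofFn p := by
    exact ⟨fun i => L.get (i.cast hL.symm), List.ext_getElem (by simp [hL]) (by simp)⟩
  obtain ⟨hle, heq⟩ := (isDyckFrom_interlacedSteps _ 0).1 hD
  have hred := countP_odd_areaWordAux _ 0 hD
  rw [mul_zero, zero_add, hword, countP_ofFn] at hred
  simp only [decide_eq_true_eq] at hred
  rw [hodd, countP_ofFn] at hred
  rw [zero_add, countP_ofFn, countP_ofFn, ← hred] at heq
  refine ⟨⟨fun i => (p i).1, fun i => (p i).2, hred.symm, heq, fun i => ?_⟩, ?_⟩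
  · have := hle (i + 1)
    rw [countP_take_ofFn, countP_take_ofFn, zero_add] at this
    simpa only [Fin.le_def, Nat.lt_succ_iff] using this
  · rw [areaWord_eq_cons]
    exact congrArg _ hword

end RedPoly

/- ## From area words to two cars parking functions -/

namespace RiseDecorated

variable {m n k : ℕ}

/-- The two-cars parking function of a reduced polyomino: the letters of the area word
after the first one, a letter `v` becoming a label `2` and a letter `v̄` becoming a
label `1`, in a row of area `v`. -/
def twoCars (P : RedPoly m n) : TwoCarsPF (m + n) where
  a i := P.letter i / 2
  l i := 2 - P.letter i % 2
  a_first i hi := by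
    have := P.getD_areaWord_succ_le 0
    rw [P.getD_areaWord_zero] at this
    simp only [RedPoly.letter, hi]
    omega
  a_step i j hij := by
    have := P.getD_areaWord_succ_le j
    have := P.getD_areaWord_succ_le (i + 1)
    simp only [RedPoly.letter, ← hij]
    omega
  col_incr i j hij := by
    have := P.getD_areaWord_succ_le (i + 1)
    simp only [RedPoly.letter, ← hij]
    omega
  l_one_le i := by omega
  l_le_two i := by omega

lemma twoCars_a (P : RedPoly m n) (i : Fin (m + n)) : (twoCars P).a i = P.letter i / 2 := rfl

lemma twoCars_l (P : RedPoly m n) (i : Fin (m + n)) : (twoCars P).l i = 2 - P.letter i % 2 :=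
  rfl

lemma exists_eq_succ_of_mem_marks (Q : RiseDecorated m n k) {d : ℕ} (hd : d ∈ Q.marks) :
    ∃ i : Fin (m + n), d = i + 1 := by
  obtain ⟨h1, h2, -⟩ := Q.marks_rise d hd
  rw [Q.poly.length_areaWord] at h2
  exact ⟨⟨d - 1, by omega⟩, by simp only; omega⟩

lemma isPFRise_twoCars_iff (P : RedPoly m n) (i : Fin (m + n)) :
    IsPFRise (twoCars P) i ↔ IsRise (areaWord P) (i + 1) := by
  have h0 := P.getD_areaWord_zero
  have hi := i.2
  have hs := P.getD_areaWord_succ_le i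
  simp only [IsPFRise, IsRise, P.length_areaWord, twoCars, RedPoly.letter,
    Nat.add_sub_cancel]
  constructor
  · rintro ⟨j, hj, h⟩
    rw [hj] at h
    omega
  · rintro ⟨-, -, h1, h2⟩
    have hpos : (i : ℕ) ≠ 0 := by
      intro h
      rw [h, h0] at h1
      omega
    refine ⟨⟨i - 1, by omega⟩, by simp only; omega, ?_⟩
    simp only [Nat.sub_add_cancel (Nat.pos_of_ne_zero hpos)]
    omega

lemma card_image_marks (Q : RiseDecorated m n k) :
    (univ.filter fun i : Fin (m + n) => (i : ℕ) + 1 ∈ Q.marks).card = k := by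
  refine Eq.trans ?_ Q.marks_card
  refine Finset.card_bij (fun i _ => (i : ℕ) + 1) (by simp) ?_ ?_
  · intro i _ j _ h
    exact Fin.ext (Nat.succ_injective h)
  · intro d hd
    obtain ⟨i, rfl⟩ := Q.exists_eq_succ_of_mem_marks hd
    exact ⟨i, by simpa using hd, rfl⟩

/-- The decorated two-cars parking function of a decorated reduced polyomino. -/
def toDecTwoCarsPF (Q : RiseDecorated m n k) : DecTwoCarsPF m n k where
  pf := twoCars Q.poly
  ones_count := by
    refine Eq.trans ?_ Q.poly.card_odd_letter
    congr 1
    ext i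
    rw [mem_filter_univ, mem_filter_univ, twoCars_l]
    omega
  twos_count := by
    have h := Q.poly.card_odd_letter
    have h' := Finset.card_filter_add_card_filter_not (s := (univ : Finset (Fin (m + n))))
      (fun i => Q.poly.letter i % 2 = 1)
    rw [h, Finset.card_univ, Fintype.card_fin] at h'
    trans (univ.filter fun i => ¬ Q.poly.letter i % 2 = 1).card
    · congr 1
      ext i
      rw [mem_filter_univ, mem_filter_univ, twoCars_l]
      omega
    · omega
  marks := univ.filter fun i => (i : ℕ) + 1 ∈ Q.marks
  marks_card := Q.card_image_marks
  marks_rise i hi := by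
    rw [isPFRise_twoCars_iff]
    exact Q.marks_rise _ (by simpa using hi)

lemma toDecTwoCarsPF_injective :
    Function.Injective (toDecTwoCarsPF (m := m) (n := n) (k := k)) := by
  intro Q Q' h
  have ha := congrArg (fun F => F.pf.a) h
  have hl := congrArg (fun F => F.pf.l) h
  have hm := congrArg DecTwoCarsPF.marks h
  have hletter : Q.poly.letter = Q'.poly.letter := by
    funext i
    have ha := congrFun ha i
    have hl := congrFun hl i
    simp only [toDecTwoCarsPF, twoCars_a, twoCars_l] at ha hl
    omega
  have hpoly : Q.poly = Q'.poly := RedPoly.areaWord_injective <| by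
    rw [RedPoly.areaWord_eq_cons_ofFn, RedPoly.areaWord_eq_cons_ofFn, hletter]
  have hmarks : Q.marks = Q'.marks := by
    have key (i : Fin (m + n)) : (i : ℕ) + 1 ∈ Q.marks ↔ (i : ℕ) + 1 ∈ Q'.marks := by
      simpa [toDecTwoCarsPF] using Finset.ext_iff.1 hm i
    ext d
    constructor
    · intro hd
      obtain ⟨i, rfl⟩ := Q.exists_eq_succ_of_mem_marks hd
      exact (key i).1 hd
    · intro hd
      obtain ⟨i, rfl⟩ := Q'.exists_eq_succ_of_mem_marks hd
      exact (key i).2 hd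
  cases Q
  cases Q'
  simp_all

lemma exists_twoCars_eq (F : TwoCarsPF (m + n))
    (hF : (univ.filter fun i => F.l i = 1).card = n) :
    ∃ P : RedPoly m n, twoCars P = F := by
  have hl (i) : F.l i = 1 ∨ F.l i = 2 := by
    have := F.l_one_le i
    have := F.l_le_two i
    omega
  obtain ⟨P, hP⟩ := RedPoly.exists_areaWord_eq (m := m) (n := n)
    (fun i => 2 * F.a i + (2 - F.l i))
    (fun i hi => by
      have := F.a_first i hi
      have := hl i
      omega)
    (fun i j hij => by
      have := F.a_step i j hij
      have := F.col_incr i j hij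
      have := hl i
      have := hl j
      omega)
    (by
      refine Eq.trans ?_ hF
      congr 1
      ext i
      have := hl i
      simp only [mem_filter, mem_univ, true_and]
      omega)
  have hletter (i) : P.letter i = 2 * F.a i + (2 - F.l i) := by
    have := P.areaWord_eq_cons_ofFn.symm.trans hP
    rw [List.cons.injEq] at this
    exact congrFun (List.ofFn_injective this.2) i
  refine ⟨P, ?_⟩
  have ha : (twoCars P).a = F.a := by
    funext i
    have := hl i
    simp only [twoCars_a, hletter]
    omega
  have hl : (twoCars P).l = F.l := by
    funext i
    have := hl i
    simp only [twoCars_l, hletter]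
    omega
  generalize twoCars P = G at ha hl
  cases G
  cases F
  simp_all

lemma toDecTwoCarsPF_surjective :
    Function.Surjective (toDecTwoCarsPF (m := m) (n := n) (k := k)) := by
  rintro ⟨F, h1, h2, M, hM, hrise⟩
  obtain ⟨P, rfl⟩ := exists_twoCars_eq F h1
  refine ⟨⟨P, M.image fun i : Fin (m + n) => (i : ℕ) + 1, ?_, ?_⟩, ?_⟩
  · rw [Finset.card_image_of_injective _ fun i j h => Fin.ext (Nat.succ_injective h), hM]
  · intro d hd
    obtain ⟨i, hi, rfl⟩ := Finset.mem_image.1 hd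
    exact (isPFRise_twoCars_iff P i).1 (hrise i hi)
  · simp only [toDecTwoCarsPF, DecTwoCarsPF.mk.injEq, true_and]
    ext i
    simp [Fin.val_inj]

lemma diagTwos_twoCars (P : RedPoly m n) :
    diagTwos (twoCars P) + 1 = (areaWord P).count 0 := by
  rw [P.areaWord_eq_cons_ofFn, List.count_cons_self, List.count, countP_ofFn, diagTwos]
  congr 2
  ext i
  rw [mem_filter_univ, mem_filter_univ, twoCars_a, twoCars_l, beq_iff_eq]
  omega

lemma pfDinv_twoCars (P : RedPoly m n) : pfDinv (twoCars P) = dinvStat P := by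
  have key (x y : ℕ) : (x / 2 = y / 2 ∧ 2 - x % 2 < 2 - y % 2 ∨
      x / 2 = y / 2 + 1 ∧ 2 - y % 2 < 2 - x % 2) ↔ x = y + 1 := by omega
  unfold pfDinv dinvStat
  simp only [twoCars, key, P.length_areaWord]
  refine Finset.card_bij (fun p _ => ((p.1 : ℕ) + 1, (p.2 : ℕ) + 1)) ?_ ?_ ?_
  · rintro ⟨i, j⟩ h
    simpa [RedPoly.letter] using h
  · rintro ⟨i, j⟩ _ ⟨i', j'⟩ _ h
    simpa [Fin.val_inj] using h
  · rintro ⟨i, j⟩ h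
    simp only [mem_filter, mem_product, mem_range] at h
    obtain ⟨⟨hi, hj⟩, hij, h⟩ := h
    have hi0 : i ≠ 0 := by
      rintro rfl
      rw [P.getD_areaWord_zero] at h
      omega
    obtain ⟨i, rfl⟩ := Nat.exists_eq_succ_of_ne_zero hi0
    obtain ⟨j, rfl⟩ := Nat.exists_eq_succ_of_ne_zero (by omega : j ≠ 0)
    refine ⟨(⟨i, by omega⟩, ⟨j, by omega⟩), ?_, rfl⟩
    refine mem_filter.2 ⟨mem_univ _, ?_, h⟩
    simpa using hij

lemma pfUArea_toDecTwoCarsPF (Q : RiseDecorated m n k) :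
    pfUArea Q.toDecTwoCarsPF = uArea Q := by
  rw [pfUArea, uArea, Q.poly.length_areaWord, Finset.sdiff_eq_filter, Finset.sdiff_eq_filter,
    Finset.sum_filter, Finset.sum_filter, Finset.sum_range_succ', Q.poly.getD_areaWord_zero,
    ← Fin.sum_univ_eq_sum_range
      (fun i => if i + 1 ∉ Q.marks then (areaWord Q.poly).getD (i + 1) 0 / 2 else 0)]
  simp [toDecTwoCarsPF, twoCars, RedPoly.letter]

end RiseDecorated

theorem stmt8 (m n k s : ℕ) (hm : 1 ≤ m) (hn : 1 ≤ n) (hs : 1 ≤ s) (hsn : s ≤ n + 1) :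
    Tstar n m s k = RPstar n m s k := by
  refine (finsum_eq_of_bijective RiseDecorated.toDecTwoCarsPF
    ⟨RiseDecorated.toDecTwoCarsPF_injective, RiseDecorated.toDecTwoCarsPF_surjective⟩
    fun Q => ?_).symm
  rw [RiseDecorated.pfUArea_toDecTwoCarsPF, ← RiseDecorated.diagTwos_twoCars,
    ← RiseDecorated.pfDinv_twoCars]
  rfl
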